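/- arXiv:2409.11943 — 2 statements merged into one kernel-verified Lean document; each statement's English description precedes it below -/
import Mathlib

section
/- Let d ≥ 1 and let g ∈ 𝒮(ℝ^{2d+1}) satisfy N g ≡ 0 on ℝ^{2d+1}. Then ( ∫_{ℝ^{2d+1}} |z|² |(∂g/∂t)(z,t)|² dz dt )^{1/2} ≤ (1/2) ‖∇_H g‖_{L²(ℝ^{2d+1})}. -/
noncomputable section

open MeasureTheory ENNReal

/-- The Heisenberg group ℍ^d modeled on ℝ^d × ℝ^d × ℝ. -/
abbrev Hd (d : ℕ) : Type := EuclideanSpace ℝ (Fin d) × EuclideanSpace ℝ (Fin d) × ℝ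

/-- The left-invariant vector field `X_j = ∂_{x_j} + 2 y_j ∂_t`. -/
def Xop (d : ℕ) (j : Fin d) (f : Hd d → ℂ) (p : Hd d) : ℂ :=
  fderiv ℝ f p (EuclideanSpace.single j 1, 0, 2 * p.2.1 j)

/-- The left-invariant vector field `Y_j = ∂_{y_j} - 2 x_j ∂_t`. -/
def Yop (d : ℕ) (j : Fin d) (f : Hd d → ℂ) (p : Hd d) : ℂ :=
  fderiv ℝ f p (0, EuclideanSpace.single j 1, -(2 * p.1 j))

/-- The vertical derivative `T = ∂_t`. -/
def Tder (d : ℕ) (f : Hd d → ℂ) (p : Hd d) : ℂ :=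
  fderiv ℝ f p (0, 0, 1)

/-- The rotation operator `N = Σ_j (y_j ∂_{x_j} - x_j ∂_{y_j})`. -/
def Nop (d : ℕ) (f : Hd d → ℂ) (p : Hd d) : ℂ :=
  fderiv ℝ f p (p.2.1, -p.1, 0)

/-- The sublaplacian `Δ_H = Σ_j (X_j² + Y_j²)`. -/
def subLap (d : ℕ) (f : Hd d → ℂ) (p : Hd d) : ℂ :=
  ∑ j : Fin d, (Xop d j (Xop d j f) p + Yop d j (Yop d j f) p)

/-- Squared length of the horizontal gradient: `|∇_H f|² = Σ_j (|X_j f|² + |Y_j f|²)`. -/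
def gradHsq (d : ℕ) (f : Hd d → ℂ) (p : Hd d) : ℝ :=
  ∑ j : Fin d, (‖Xop d j f p‖ ^ 2 + ‖Yop d j f p‖ ^ 2)

/-- `|z|² = |x|² + |y|²`. -/
def zsq (d : ℕ) (p : Hd d) : ℝ := ‖p.1‖ ^ 2 + ‖p.2.1‖ ^ 2

/-- `|z|`. -/
def zn (d : ℕ) (p : Hd d) : ℝ := Real.sqrt (zsq d p)

/-- The weight `w₁(z,t) = |z| (1+|z|²)^{-1/2} (1 + (|z|⁴+t²)^{1/2})⁻¹`. -/
def w1 (d : ℕ) (p : Hd d) : ℝ :=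
  zn d p / Real.sqrt (1 + zn d p ^ 2) / (1 + Real.sqrt (zn d p ^ 4 + p.2.2 ^ 2))

/-- The weight `w₂(z,t) = (1+|z|²+t²)^{-1/2}`. -/
def w2 (d : ℕ) (p : Hd d) : ℝ :=
  (Real.sqrt (1 + zsq d p + p.2.2 ^ 2))⁻¹

/-- The weight `w₄(z,t) = |z| (|z|⁴+t²)^{-1/2}`. -/
def w4 (d : ℕ) (p : Hd d) : ℝ :=
  zn d p / Real.sqrt (zn d p ^ 4 + p.2.2 ^ 2)

/-- A Schwartz function's derivative, applied to a continuous vector field of at most linear growth,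
is square integrable. -/
lemma integrable_norm_sq_fderiv_apply {E : Type*} [NormedAddCommGroup E] [NormedSpace ℝ E]
    [MeasurableSpace E] [BorelSpace E] [SecondCountableTopology E] (μ : Measure E)
    [μ.HasTemperateGrowth] (g : SchwartzMap E ℂ) (v : E → E) (hv : Continuous v)
    (hbound : ∀ p, ‖v p‖ ≤ 1 + 2 * ‖p‖) :
    Integrable (fun p => ‖fderiv ℝ g p (v p)‖ ^ 2) μ := by
  set F : SchwartzMap E (E →L[ℝ] ℂ) := SchwartzMap.fderivCLM ℝ E ℂ g with hF
  have hFg : ∀ p, F p = fderiv ℝ g p := fun p => rfl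
  obtain ⟨C, hC⟩ : ∃ C, ∀ p, ‖F p‖ ≤ C := by
    obtain ⟨C, -, hC⟩ := F.decay 0 0
    exact ⟨C, fun p => by simpa using hC p⟩
  have hcont : Continuous (fun p => ‖fderiv ℝ g p (v p)‖ ^ 2) := by
    simp only [← hFg]
    exact ((F.continuous.clm_apply hv).norm).pow 2
  have hint : Integrable (fun p => C * (2 * (‖p‖ ^ 0 * ‖F p‖) + 8 * (‖p‖ ^ 2 * ‖F p‖))) μ :=
    (((F.integrable_pow_mul μ 0).const_mul 2).add
      ((F.integrable_pow_mul μ 2).const_mul 8)).const_mul C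
  refine hint.mono' hcont.aestronglyMeasurable (Filter.Eventually.of_forall fun p => ?_)
  rw [Real.norm_of_nonneg (by positivity), ← hFg]
  have hop : ‖F p (v p)‖ ≤ ‖F p‖ * (1 + 2 * ‖p‖) :=
    (F p).le_of_opNorm_le_of_le le_rfl (hbound p)
  calc ‖F p (v p)‖ ^ 2 ≤ (‖F p‖ * (1 + 2 * ‖p‖)) ^ 2 := by gcongr
    _ = ‖F p‖ * (‖F p‖ * (1 + 2 * ‖p‖) ^ 2) := by ring
    _ ≤ C * (‖F p‖ * (2 + 8 * ‖p‖ ^ 2)) := by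
      have hC0 : 0 ≤ C := (norm_nonneg _).trans (hC p)
      gcongr
      · exact hC p
      · nlinarith [sq_nonneg (1 - 2 * ‖p‖)]
    _ = C * (2 * (‖p‖ ^ 0 * ‖F p‖) + 8 * (‖p‖ ^ 2 * ‖F p‖)) := by ring

lemma integrable_gradHsq (d : ℕ) (g : SchwartzMap (Hd d) ℂ) :
    Integrable (gradHsq d g) := by
  have : (volume : Measure (EuclideanSpace ℝ (Fin d) × ℝ)).IsAddHaarMeasure :=
    Measure.prod.instIsAddHaarMeasure volume volume
  have : (volume : Measure (Hd d)).IsAddHaarMeasure :=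
    Measure.prod.instIsAddHaarMeasure volume volume
  have hx : ∀ (p : Hd d) (j : Fin d), |p.1 j| ≤ ‖p‖ := fun p j =>
    (PiLp.norm_apply_le p.1 j).trans (norm_fst_le p)
  have hy : ∀ (p : Hd d) (j : Fin d), |p.2.1 j| ≤ ‖p‖ := fun p j =>
    (PiLp.norm_apply_le p.2.1 j).trans ((norm_fst_le p.2).trans (norm_snd_le p))
  refine integrable_finsetSum _ fun j _ => Integrable.add ?_ ?_
  · refine integrable_norm_sq_fderiv_apply volume g _ (by fun_prop) fun p => ?_
    simp only [Prod.norm_def, PiLp.norm_single, norm_one, norm_zero, norm_mul,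
      Real.norm_eq_abs, abs_two]
    have := hy p j
    have := norm_nonneg p
    simp only [Prod.norm_def, Real.norm_eq_abs] at *
    refine max_le (by linarith) (max_le (by linarith) (by linarith))
  · refine integrable_norm_sq_fderiv_apply volume g _ (by fun_prop) fun p => ?_
    simp only [Prod.norm_def, PiLp.norm_single, norm_one, norm_zero, norm_neg, norm_mul,
      Real.norm_eq_abs, abs_two]
    have := hx p j
    have := norm_nonneg p
    simp only [Prod.norm_def, Real.norm_eq_abs] at *
    refine max_le (by linarith) (max_le (by linarith) (by linarith))

/-- The identity `Σ_j (y_j X_j - x_j Y_j) = N + 2|z|² ∂_t`. -/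
lemma sum_mul_Xop_sub_mul_Yop (d : ℕ) (f : Hd d → ℂ) (p : Hd d) :
    ∑ j : Fin d, ((p.2.1 j : ℂ) * Xop d j f p - (p.1 j : ℂ) * Yop d j f p) =
      Nop d f p + 2 * zsq d p * Tder d f p := by
  have hvec : ∑ j : Fin d, (p.2.1 j • ((EuclideanSpace.single j 1, 0, 2 * p.2.1 j) : Hd d)
        - p.1 j • ((0, EuclideanSpace.single j 1, -(2 * p.1 j)) : Hd d)) =
      (p.2.1, -p.1, 0) + (2 * zsq d p) • ((0, 0, 1) : Hd d) := by
    refine Prod.ext ?_ (Prod.ext ?_ ?_)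
    · ext i
      simp [Prod.fst_sum, Pi.single_apply]
    · ext i
      simp [Prod.fst_sum, Prod.snd_sum, Pi.single_apply]
    · simp only [Prod.snd_sum, Prod.snd_sub, Prod.snd_add, Prod.smul_snd, smul_eq_mul, zsq,
        EuclideanSpace.real_norm_sq_eq, ← Finset.sum_add_distrib, Finset.mul_sum, mul_one, zero_add]
      exact Finset.sum_congr rfl fun j _ => by ring
  have h := congrArg (fderiv ℝ f p) hvec
  simp only [map_sum, map_sub, map_add, map_smul, Complex.real_smul] at h
  simpa [Xop, Yop, Nop, Tder] using h

/-- Pointwise bound `4 |z|² |∂_t f|² ≤ |∇_H f|²` wherever `N f` vanishes. -/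
lemma four_mul_zsq_mul_norm_Tder_sq_le (d : ℕ) (f : Hd d → ℂ) (p : Hd d) (h : Nop d f p = 0) :
    4 * (zsq d p * ‖Tder d f p‖ ^ 2) ≤ gradHsq d f p := by
  have hz : 0 ≤ zsq d p := by unfold zsq; positivity
  have hG : 0 ≤ gradHsq d f p := by unfold gradHsq; positivity
  have hzsum : zsq d p = ∑ j, (p.2.1 j ^ 2 + p.1 j ^ 2) := by
    simp [zsq, EuclideanSpace.real_norm_sq_eq, Finset.sum_add_distrib, add_comm]
  have hnorm : 2 * zsq d p * ‖Tder d f p‖ ≤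
      ∑ j, (|p.2.1 j| * ‖Xop d j f p‖ + |p.1 j| * ‖Yop d j f p‖) := by
    have hid := sum_mul_Xop_sub_mul_Yop d f p
    rw [h, zero_add] at hid
    calc 2 * zsq d p * ‖Tder d f p‖ = ‖(2 * zsq d p * Tder d f p : ℂ)‖ := by
          simp [abs_of_nonneg hz]
      _ ≤ _ := by
          rw [← hid]
          refine norm_sum_le_of_le _ fun j _ => (norm_sub_le _ _).trans_eq (by simp)
  have hcs : (∑ j, (|p.2.1 j| * ‖Xop d j f p‖ + |p.1 j| * ‖Yop d j f p‖)) ^ 2 ≤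
      zsq d p * gradHsq d f p := by
    rw [hzsum, gradHsq]
    refine Finset.sum_sq_le_sum_mul_sum_of_sq_le_mul _ (fun _ _ => by positivity)
      (fun _ _ => by positivity) fun j _ => ?_
    rw [← sq_abs (p.2.1 j), ← sq_abs (p.1 j)]
    nlinarith [sq_nonneg (|p.2.1 j| * ‖Yop d j f p‖ - |p.1 j| * ‖Xop d j f p‖)]
  rcases hz.eq_or_lt with h0 | hpos
  · simpa [← h0] using hG
  · refine le_of_mul_le_mul_left ?_ hpos
    calc zsq d p * (4 * (zsq d p * ‖Tder d f p‖ ^ 2)) = (2 * zsq d p * ‖Tder d f p‖) ^ 2 := by ring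
      _ ≤ _ := (pow_le_pow_left₀ (by positivity) hnorm 2).trans hcs

/-- For Schwartz `g` with `N g ≡ 0`,
`(∫ |z|² |∂g/∂t|²)^{1/2} ≤ ½ ‖∇_H g‖_{L²}`. -/
theorem weighted_vertical_derivative_bound_kerN (d : ℕ) (hd : 1 ≤ d)
    (g : SchwartzMap (Hd d) ℂ) (hg : ∀ p : Hd d, Nop d (⇑g) p = 0) :
    Real.sqrt (∫ p, zsq d p * ‖Tder d (⇑g) p‖ ^ 2) ≤
      (1/2) * Real.sqrt (∫ p, gradHsq d (⇑g) p) := by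
  have hmono : 4 * ∫ p, zsq d p * ‖Tder d g p‖ ^ 2 ≤ ∫ p, gradHsq d g p := by
    rw [← integral_const_mul]
    refine integral_mono_of_nonneg (Filter.Eventually.of_forall fun p => ?_)
      (integrable_gradHsq d g) (Filter.Eventually.of_forall fun p =>
        four_mul_zsq_mul_norm_Tder_sq_le d g p (hg p))
    simp only [zsq, Pi.zero_apply]
    positivity
  refine Real.sqrt_le_iff.mpr ⟨by positivity, ?_⟩
  have hG : 0 ≤ ∫ p, gradHsq d g p :=
    integral_nonneg fun p => by simp only [gradHsq, Pi.zero_apply]; positivity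
  rw [mul_pow, Real.sq_sqrt hG]
  linarith
end
end

section
/- (Subordination of potentials dominated by w₁².) Let d ≥ 1 and C₁ > 0, and let V : ℝ^{2d+1} → ℂ be measurable with |V(z,t)| ≤ C₁ w₁(z,t)² for almost every (z,t), where w₁(z,t) = |z| (1+|z|²)^{−1/2} (1 + (|z|⁴+t²)^{1/2})^{−1}. Then for every ψ ∈ 𝒮(ℝ^{2d+1}), ∫_{ℝ^{2d+1}} |V(z,t)| |ψ(z,t)|² dz dt ≤ C₁ d^{−2} ∫_{ℝ^{2d+1}} |∇_H ψ(z,t)|² dz dt. -/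
noncomputable section

open MeasureTheory ENNReal

open scoped SchwartzMap

/-- A directional derivative of a Schwartz function is integrable. -/
lemma SchwartzMap.integrable_fderiv_apply {E : Type*} [NormedAddCommGroup E] [NormedSpace ℝ E]
    [MeasurableSpace E] [BorelSpace E] [FiniteDimensional ℝ E] {μ : Measure E}
    [μ.IsAddHaarMeasure] (S : 𝓢(E, ℝ)) (v : E) : Integrable (fun x ↦ fderiv ℝ S x v) μ :=
  (SchwartzMap.evalCLM ℝ E ℝ v (SchwartzMap.fderivCLM ℝ E ℝ S)).integrable

/-- A directional derivative of a Schwartz function has integral zero. -/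
lemma SchwartzMap.integral_fderiv_apply {E : Type*} [NormedAddCommGroup E] [NormedSpace ℝ E]
    [MeasurableSpace E] [BorelSpace E] [FiniteDimensional ℝ E] {μ : Measure E}
    [μ.IsAddHaarMeasure] (S : 𝓢(E, ℝ)) (v : E) : ∫ x, fderiv ℝ S x v ∂μ = 0 := by
  simpa using integral_mul_fderiv_eq_neg_fderiv_mul_of_integrable (μ := μ)
    (f := fun _ : E ↦ (1 : ℝ)) (g := S) (v := v) (by simp)
    (by simpa using S.integrable_fderiv_apply v) (by simpa using S.integrable)
    (fun _ _ ↦ by fun_prop) (fun _ _ ↦ S.differentiableAt)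

/-- The Schwartz function `|ψ|²`. -/
def normSqSchwartz {E : Type*} [NormedAddCommGroup E] [NormedSpace ℝ E] (ψ : 𝓢(E, ℂ)) :
    𝓢(E, ℝ) :=
  SchwartzMap.pairing (𝕜 := ℝ) (innerSL ℝ) ψ ψ

lemma normSqSchwartz_apply {E : Type*} [NormedAddCommGroup E] [NormedSpace ℝ E]
    (ψ : 𝓢(E, ℂ)) (p : E) : normSqSchwartz ψ p = ‖ψ p‖ ^ 2 :=
  real_inner_self_eq_norm_sq (ψ p)

lemma fderiv_normSqSchwartz {E : Type*} [NormedAddCommGroup E] [NormedSpace ℝ E]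
    (ψ : 𝓢(E, ℂ)) (p v : E) :
    fderiv ℝ (normSqSchwartz ψ) p v = 2 * inner ℝ (ψ p) (fderiv ℝ ψ p v) := by
  have : (normSqSchwartz ψ : E → ℝ) = fun q ↦ ‖ψ q‖ ^ 2 := funext (normSqSchwartz_apply ψ)
  rw [this, (ψ.hasFDerivAt p).norm_sq.fderiv]
  simp [mul_add]

/-- The weight `(1 + |z|⁴ + t²)⁻¹`. -/
def regWeight (d : ℕ) (p : Hd d) : ℝ := (1 + (zsq d p ^ 2 + p.2.2 ^ 2))⁻¹

@[fun_prop]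
lemma hasTemperateGrowth_fst (d : ℕ) (j : Fin d) :
    (fun p : Hd d ↦ p.1 j).HasTemperateGrowth :=
  ((EuclideanSpace.proj j : EuclideanSpace ℝ (Fin d) →L[ℝ] ℝ) ∘L
    ContinuousLinearMap.fst ℝ _ _ : Hd d →L[ℝ] ℝ).hasTemperateGrowth

@[fun_prop]
lemma hasTemperateGrowth_snd_fst (d : ℕ) (j : Fin d) :
    (fun p : Hd d ↦ p.2.1 j).HasTemperateGrowth :=
  ((EuclideanSpace.proj j : EuclideanSpace ℝ (Fin d) →L[ℝ] ℝ) ∘L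
    ContinuousLinearMap.fst ℝ _ _ ∘L ContinuousLinearMap.snd ℝ _ _ : Hd d →L[ℝ] ℝ).hasTemperateGrowth

@[fun_prop]
lemma hasTemperateGrowth_snd_snd (d : ℕ) : (fun p : Hd d ↦ p.2.2).HasTemperateGrowth :=
  (ContinuousLinearMap.snd ℝ _ _ ∘L ContinuousLinearMap.snd ℝ _ _ :
    Hd d →L[ℝ] ℝ).hasTemperateGrowth

lemma zsq_eq_sum (d : ℕ) (p : Hd d) : zsq d p = ∑ j, (p.1 j ^ 2 + p.2.1 j ^ 2) := by
  simp [zsq, EuclideanSpace.norm_sq_eq, Finset.sum_add_distrib]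

@[fun_prop]
lemma hasTemperateGrowth_zsq (d : ℕ) : (zsq d).HasTemperateGrowth := by
  rw [funext (zsq_eq_sum d)]
  fun_prop

@[fun_prop]
lemma hasTemperateGrowth_regWeight (d : ℕ) : (regWeight d).HasTemperateGrowth := by
  have h1 : (fun p : Hd d ↦ Complex.ofReal (zsq d p)).HasTemperateGrowth :=
    Function.Complex.hasTemperateGrowth_ofReal.comp (hasTemperateGrowth_zsq d)
  have h2 : (fun p : Hd d ↦ Complex.ofReal p.2.2).HasTemperateGrowth :=
    Function.Complex.hasTemperateGrowth_ofReal.comp (hasTemperateGrowth_snd_snd d)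
  have h3 : (fun p : Hd d ↦ (zsq d p : ℂ) + p.2.2 * Complex.I).HasTemperateGrowth := by fun_prop
  have h4 : regWeight d = (fun w : ℂ ↦ (1 + ‖w‖ ^ 2) ^ (-1 : ℝ)) ∘
      fun p : Hd d ↦ (zsq d p : ℂ) + p.2.2 * Complex.I := by
    ext p
    simp [regWeight, Real.rpow_neg_one, ← Complex.normSq_eq_norm_sq, Complex.normSq_add_mul_I]
  rw [h4]
  exact (Function.hasTemperateGrowth_one_add_norm_sq_rpow ℂ (-1)).comp h3

lemma fderiv_fst_apply (d : ℕ) (j : Fin d) (p v : Hd d) :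
    fderiv ℝ (fun p : Hd d ↦ p.1 j) p v = v.1 j := by
  exact congrArg (· v) ((EuclideanSpace.proj j : EuclideanSpace ℝ (Fin d) →L[ℝ] ℝ) ∘L
    ContinuousLinearMap.fst ℝ _ _ : Hd d →L[ℝ] ℝ).fderiv

lemma fderiv_snd_fst_apply (d : ℕ) (j : Fin d) (p v : Hd d) :
    fderiv ℝ (fun p : Hd d ↦ p.2.1 j) p v = v.2.1 j := by
  exact congrArg (· v) ((EuclideanSpace.proj j : EuclideanSpace ℝ (Fin d) →L[ℝ] ℝ) ∘L
    ContinuousLinearMap.fst ℝ _ _ ∘L ContinuousLinearMap.snd ℝ _ _ : Hd d →L[ℝ] ℝ).fderiv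

lemma fderiv_snd_snd_apply (d : ℕ) (p v : Hd d) :
    fderiv ℝ (fun p : Hd d ↦ p.2.2) p v = v.2.2 := by
  exact congrArg (· v) (ContinuousLinearMap.snd ℝ _ _ ∘L ContinuousLinearMap.snd ℝ _ _ :
    Hd d →L[ℝ] ℝ).fderiv

lemma fderiv_zsq_apply (d : ℕ) (p v : Hd d) :
    fderiv ℝ (zsq d) p v = 2 * inner ℝ p.1 v.1 + 2 * inner ℝ p.2.1 v.2.1 := by
  have h : HasFDerivAt (zsq d) _ p :=
    (hasFDerivAt_fst (𝕜 := ℝ) (p := p)).norm_sq.add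
      ((hasFDerivAt_fst (𝕜 := ℝ) (p := p.2)).comp p hasFDerivAt_snd).norm_sq
  rw [h.fderiv]
  simp

lemma fderiv_regWeight_apply (d : ℕ) (p v : Hd d) :
    fderiv ℝ (regWeight d) p v =
      -(regWeight d p ^ 2 * (2 * zsq d p * fderiv ℝ (zsq d) p v + 2 * p.2.2 * v.2.2)) := by
  have hz := ((hasTemperateGrowth_zsq d).1.differentiable (by simp) p).hasFDerivAt
  have ht := ((hasTemperateGrowth_snd_snd d).1.differentiable (by simp) p).hasFDerivAt
  have hpos : (1 + (zsq d p ^ 2 + p.2.2 ^ 2)) ≠ 0 := by positivity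
  have h : HasFDerivAt (regWeight d) _ p :=
    (hasDerivAt_inv hpos).comp_hasFDerivAt p (((hz.pow 2).add (ht.pow 2)).const_add 1)
  rw [h.fderiv]
  simp [fderiv_snd_snd_apply, regWeight]
  ring

/-- The function `X_j (|z|⁴ + t²) / 4`. -/
def fieldX (d : ℕ) (j : Fin d) (p : Hd d) : ℝ := zsq d p * p.1 j + p.2.1 j * p.2.2

/-- The function `Y_j (|z|⁴ + t²) / 4`. -/
def fieldY (d : ℕ) (j : Fin d) (p : Hd d) : ℝ := zsq d p * p.2.1 j - p.1 j * p.2.2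

/-- The vertical Euclidean component of `∑ j, fieldX j • X_j + fieldY j • Y_j`. -/
def fieldT (d : ℕ) (p : Hd d) : ℝ := 2 * (zsq d p * p.2.2)

@[fun_prop]
lemma hasTemperateGrowth_fieldX (d : ℕ) (j : Fin d) : (fieldX d j).HasTemperateGrowth := by
  unfold fieldX; fun_prop

@[fun_prop]
lemma hasTemperateGrowth_fieldY (d : ℕ) (j : Fin d) : (fieldY d j).HasTemperateGrowth := by
  unfold fieldY; fun_prop

@[fun_prop]
lemma hasTemperateGrowth_fieldT (d : ℕ) : (fieldT d).HasTemperateGrowth := by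
  unfold fieldT; fun_prop

lemma Function.HasTemperateGrowth.differentiableAt {E F : Type*} [NormedAddCommGroup E]
    [NormedSpace ℝ E] [NormedAddCommGroup F] [NormedSpace ℝ F] {f : E → F}
    (hf : f.HasTemperateGrowth) (p : E) : DifferentiableAt ℝ f p :=
  hf.1.differentiable (by simp) p

lemma fderiv_fieldX_apply (d : ℕ) (j : Fin d) (p : Hd d) :
    fderiv ℝ (fieldX d j) p (EuclideanSpace.single j 1, 0, 0) = 2 * p.1 j ^ 2 + zsq d p := by
  have h : HasFDerivAt (fieldX d j) _ p :=
    ((hasTemperateGrowth_zsq d).differentiableAt p).hasFDerivAt.mul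
      ((hasTemperateGrowth_fst d j).differentiableAt p).hasFDerivAt |>.add
    (((hasTemperateGrowth_snd_fst d j).differentiableAt p).hasFDerivAt.mul
      ((hasTemperateGrowth_snd_snd d).differentiableAt p).hasFDerivAt)
  rw [h.fderiv]
  simp [fderiv_zsq_apply, fderiv_fst_apply, fderiv_snd_fst_apply, fderiv_snd_snd_apply,
    EuclideanSpace.inner_single_right]
  ring

lemma fderiv_fieldY_apply (d : ℕ) (j : Fin d) (p : Hd d) :
    fderiv ℝ (fieldY d j) p (0, EuclideanSpace.single j 1, 0) = 2 * p.2.1 j ^ 2 + zsq d p := by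
  have h : HasFDerivAt (fieldY d j) _ p :=
    ((hasTemperateGrowth_zsq d).differentiableAt p).hasFDerivAt.mul
      ((hasTemperateGrowth_snd_fst d j).differentiableAt p).hasFDerivAt |>.sub
    (((hasTemperateGrowth_fst d j).differentiableAt p).hasFDerivAt.mul
      ((hasTemperateGrowth_snd_snd d).differentiableAt p).hasFDerivAt)
  rw [h.fderiv]
  simp [fderiv_zsq_apply, fderiv_fst_apply, fderiv_snd_fst_apply, fderiv_snd_snd_apply,
    EuclideanSpace.inner_single_right]
  ring

lemma fderiv_fieldT_apply (d : ℕ) (p : Hd d) :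
    fderiv ℝ (fieldT d) p (0, 0, 1) = 2 * zsq d p := by
  have h : HasFDerivAt (fieldT d) _ p :=
    (((hasTemperateGrowth_zsq d).differentiableAt p).hasFDerivAt.mul
      ((hasTemperateGrowth_snd_snd d).differentiableAt p).hasFDerivAt).const_mul 2
  rw [h.fderiv]
  simp [fderiv_zsq_apply, fderiv_snd_snd_apply]

/-- The Schwartz function `A φ / (1 + |z|⁴ + t²)`. -/
def flux (d : ℕ) (A : Hd d → ℝ) (φ : 𝓢(Hd d, ℝ)) : 𝓢(Hd d, ℝ) :=
  SchwartzMap.smulLeftCLM ℝ (fun p ↦ regWeight d p * A p) φ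

lemma fderiv_flux_apply (d : ℕ) {A : Hd d → ℝ} (hA : A.HasTemperateGrowth) (φ : 𝓢(Hd d, ℝ))
    (p v : Hd d) :
    fderiv ℝ (flux d A φ) p v = regWeight d p * A p * fderiv ℝ φ p v +
      (regWeight d p * fderiv ℝ A p v + fderiv ℝ (regWeight d) p v * A p) * φ p := by
  have h : (flux d A φ : Hd d → ℝ) = fun p ↦ regWeight d p * A p * φ p := by
    ext q
    rw [flux, SchwartzMap.smulLeftCLM_apply_apply (by fun_prop), smul_eq_mul]
  have h' : HasFDerivAt (fun p ↦ regWeight d p * A p * φ p) _ p :=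
    (((hasTemperateGrowth_regWeight d).differentiableAt p).hasFDerivAt.mul
      (hA.differentiableAt p).hasFDerivAt).mul (φ.hasFDerivAt p)
  rw [h, h'.fderiv]
  simp
  ring

/-- The Euclidean divergence of `d φ (1 + |z|⁴ + t²)⁻¹ (∑ j, fieldX j • X_j + fieldY j • Y_j)`. -/
def hardyDiv (d : ℕ) (φ : 𝓢(Hd d, ℝ)) (p : Hd d) : ℝ :=
  d * (∑ j, (fderiv ℝ (flux d (fieldX d j) φ) p (EuclideanSpace.single j 1, 0, 0) +
    fderiv ℝ (flux d (fieldY d j) φ) p (0, EuclideanSpace.single j 1, 0)) +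
    fderiv ℝ (flux d (fieldT d) φ) p (0, 0, 1))

instance isAddHaarMeasure_volume_Hd (d : ℕ) : (volume : Measure (Hd d)).IsAddHaarMeasure :=
  Measure.prod.instIsAddHaarMeasure volume (volume.prod volume)

lemma integrable_hardyDiv (d : ℕ) (φ : 𝓢(Hd d, ℝ)) : Integrable (hardyDiv d φ) :=
  ((integrable_finsetSum _ fun _ _ ↦ (SchwartzMap.integrable_fderiv_apply _ _).add
    (SchwartzMap.integrable_fderiv_apply _ _)).add
    (SchwartzMap.integrable_fderiv_apply _ _)).const_mul _

lemma integral_hardyDiv (d : ℕ) (φ : 𝓢(Hd d, ℝ)) : ∫ p, hardyDiv d φ p = 0 := by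
  unfold hardyDiv
  rw [integral_const_mul, integral_add, integral_finsetSum]
  · simp_rw [integral_add (SchwartzMap.integrable_fderiv_apply _ _)
      (SchwartzMap.integrable_fderiv_apply _ _), SchwartzMap.integral_fderiv_apply]
    simp
  · exact fun _ _ ↦ (SchwartzMap.integrable_fderiv_apply _ _).add
      (SchwartzMap.integrable_fderiv_apply _ _)
  · exact integrable_finsetSum _ fun _ _ ↦ (SchwartzMap.integrable_fderiv_apply _ _).add
      (SchwartzMap.integrable_fderiv_apply _ _)
  · exact SchwartzMap.integrable_fderiv_apply _ _

/-- Completing the square: `0 ≤ |a + s u|²`. -/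
lemma norm_sq_add_inner_nonneg (a u : ℂ) (s : ℝ) :
    0 ≤ ‖a‖ ^ 2 + s * (2 * inner ℝ u a) + s ^ 2 * ‖u‖ ^ 2 := by
  have h := norm_add_sq_real a (s • u)
  rw [norm_smul, real_inner_smul_right, mul_pow, Real.norm_eq_abs, sq_abs,
    real_inner_comm] at h
  nlinarith [sq_nonneg ‖a + s • u‖]

lemma zsq_mul_le_hardyDiv_add_gradHsq (d : ℕ) (ψ : 𝓢(Hd d, ℂ)) (p : Hd d) :
    (d : ℝ) ^ 2 * (zsq d p * regWeight d p * ‖ψ p‖ ^ 2) ≤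
      hardyDiv d (normSqSchwartz ψ) p + gradHsq d ψ p := by
  set φ := normSqSchwartz ψ with hφ
  set h := regWeight d p with hh
  set ρ := zsq d p with hρ
  set t := p.2.2 with ht
  set c := fderiv ℝ φ p (0, 0, 1) with hc
  have hφp : φ p = ‖ψ p‖ ^ 2 := normSqSchwartz_apply ψ p
  have hGh : h * (ρ ^ 2 + t ^ 2) = 1 - h := by
    have : (1 + (ρ ^ 2 + t ^ 2)) ≠ 0 := by positivity
    rw [hh, regWeight, ← hρ, ← ht]
    field_simp
    ring
  have key (j : Fin d) :
      (-(2 * d * h * t * c) - d ^ 2 * h * (1 - h) * φ p + d * (2 * h - 4 * h ^ 2 * ρ ^ 2) * φ p) *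
          (p.1 j ^ 2 + p.2.1 j ^ 2) + d * 2 * h * ρ * φ p ≤
        d * (fderiv ℝ (flux d (fieldX d j) φ) p (EuclideanSpace.single j 1, 0, 0) +
          fderiv ℝ (flux d (fieldY d j) φ) p (0, EuclideanSpace.single j 1, 0)) +
        (‖Xop d j ψ p‖ ^ 2 + ‖Yop d j ψ p‖ ^ 2) := by
    have hX := norm_sq_add_inner_nonneg (Xop d j ψ p) (ψ p) (d * h * fieldX d j p)
    have hY := norm_sq_add_inner_nonneg (Yop d j ψ p) (ψ p) (d * h * fieldY d j p)
    have eX : 2 * inner ℝ (ψ p) (Xop d j ψ p) =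
        fderiv ℝ φ p (EuclideanSpace.single j 1, 0, 0) + 2 * p.2.1 j * c := by
      rw [Xop, ← fderiv_normSqSchwartz, hc, ← hφ, ← smul_eq_mul (2 * p.2.1 j), ← map_smul, ← map_add]
      simp
    have eY : 2 * inner ℝ (ψ p) (Yop d j ψ p) =
        fderiv ℝ φ p (0, EuclideanSpace.single j 1, 0) - 2 * p.1 j * c := by
      rw [Yop, ← fderiv_normSqSchwartz, hc, ← hφ, ← smul_eq_mul (2 * p.1 j), ← map_smul, ← map_sub]
      simp
    rw [eX, ← hφp] at hX
    rw [eY, ← hφp] at hY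
    rw [fderiv_flux_apply d (by fun_prop), fderiv_flux_apply d (by fun_prop),
      fderiv_fieldX_apply, fderiv_fieldY_apply, fderiv_regWeight_apply, fderiv_regWeight_apply,
      fderiv_zsq_apply, fderiv_zsq_apply]
    simp only [fieldX, fieldY, ← hh, ← hρ, ← ht] at hX hY ⊢
    simp [EuclideanSpace.inner_single_right]
    linear_combination hX + hY + d ^ 2 * h * φ p * (p.1 j ^ 2 + p.2.1 j ^ 2) * hGh
  have hsum := Finset.sum_le_sum fun j (_ : j ∈ Finset.univ) ↦ key j
  rw [Finset.sum_add_distrib, ← Finset.mul_sum, ← zsq_eq_sum, ← hρ, Finset.sum_add_distrib]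
    at hsum
  have hT : fderiv ℝ (flux d (fieldT d) φ) p (0, 0, 1) =
      h * (2 * (ρ * t)) * c + (h * (2 * ρ) - h ^ 2 * (2 * t) * (2 * (ρ * t))) * φ p := by
    rw [fderiv_flux_apply d (by fun_prop), fderiv_fieldT_apply, fderiv_regWeight_apply,
      fderiv_zsq_apply]
    simp only [fieldT, ← hh, ← hρ, ← ht]
    simp
    ring
  have h0 : 0 ≤ d ^ 2 * h ^ 2 * ρ * φ p + 4 * d * h ^ 2 * ρ * φ p := by
    have : 0 ≤ ρ := by rw [hρ, zsq]; positivity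
    rw [hφp]
    positivity
  rw [hardyDiv, mul_add, Finset.mul_sum, gradHsq, hT, ← hφp]
  rw [← Finset.mul_sum, Finset.sum_const, Finset.card_univ, Fintype.card_fin, nsmul_eq_mul] at hsum
  linear_combination hsum + h0 + (4 * d * h * ρ * φ p) * hGh

lemma w1_sq_le (d : ℕ) (p : Hd d) : w1 d p ^ 2 ≤ zsq d p * regWeight d p := by
  have hz : 0 ≤ zsq d p := by unfold zsq; positivity
  have h4 : zn d p ^ 4 = zsq d p ^ 2 := by
    rw [zn, show 4 = 2 * 2 from rfl, pow_mul, Real.sq_sqrt hz]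
  rw [w1, h4, zn, regWeight, div_pow, div_pow, Real.sq_sqrt hz, Real.sq_sqrt (by positivity),
    ← div_eq_mul_inv]
  gcongr
  · exact div_le_self hz (by linarith)
  · nlinarith [Real.sqrt_nonneg (zsq d p ^ 2 + p.2.2 ^ 2),
      Real.sq_sqrt (show 0 ≤ zsq d p ^ 2 + p.2.2 ^ 2 by positivity)]

lemma gradHsq_nonneg (d : ℕ) (f : Hd d → ℂ) (p : Hd d) : 0 ≤ gradHsq d f p := by
  unfold gradHsq; positivity

lemma continuous_gradHsq (d : ℕ) (ψ : 𝓢(Hd d, ℂ)) : Continuous (gradHsq d ψ) := by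
  have h : Continuous (fderiv ℝ ψ) := (SchwartzMap.fderivCLM ℝ (Hd d) ℂ ψ).continuous
  unfold gradHsq Xop Yop
  fun_prop

/-- A Hardy inequality on the Heisenberg group with a regularised weight. -/
lemma lintegral_hardy (d : ℕ) (ψ : 𝓢(Hd d, ℂ)) :
    ∫⁻ p, ENNReal.ofReal ((d : ℝ) ^ 2 * (zsq d p * regWeight d p * ‖ψ p‖ ^ 2)) ≤
      ∫⁻ p, ENNReal.ofReal (gradHsq d ψ p) := by
  by_cases htop : ∫⁻ p, ENNReal.ofReal (gradHsq d ψ p) = ⊤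
  · simp [htop]
  have hg : Integrable (gradHsq d ψ) :=
    (lintegral_ofReal_ne_top_iff_integrable (continuous_gradHsq d ψ).aestronglyMeasurable
      (.of_forall (gradHsq_nonneg d ψ))).1 htop
  have hD := integrable_hardyDiv d (normSqSchwartz ψ)
  have hnn (p : Hd d) : 0 ≤ (d : ℝ) ^ 2 * (zsq d p * regWeight d p * ‖ψ p‖ ^ 2) := by
    unfold regWeight zsq; positivity
  have hle := zsq_mul_le_hardyDiv_add_gradHsq d ψ
  calc _ ≤ ∫⁻ p, ENNReal.ofReal (hardyDiv d (normSqSchwartz ψ) p + gradHsq d ψ p) :=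
        lintegral_mono fun p ↦ ENNReal.ofReal_le_ofReal (hle p)
    _ = ENNReal.ofReal (∫ p, (hardyDiv d (normSqSchwartz ψ) p + gradHsq d ψ p)) :=
        (ofReal_integral_eq_lintegral_ofReal (hD.add hg)
          (.of_forall fun p ↦ (hnn p).trans (hle p))).symm
    _ = ENNReal.ofReal (∫ p, gradHsq d ψ p) := by
        rw [integral_add hD hg, integral_hardyDiv, zero_add]
    _ = _ := ofReal_integral_eq_lintegral_ofReal hg (.of_forall (gradHsq_nonneg d ψ))

/-- Subordination of potentials dominated by `w₁²`: if
`|V| ≤ C₁ w₁²` a.e., then `∫ |V| |ψ|² ≤ C₁ d⁻² ∫ |∇_H ψ|²` for every Schwartz `ψ`. -/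
theorem potential_subordination_w1 (d : ℕ) (hd : 1 ≤ d) (C₁ : ℝ) (hC₁ : 0 < C₁)
    (V : Hd d → ℂ) (hV_meas : Measurable V)
    (hV : ∀ᵐ p : Hd d ∂volume, ‖V p‖ ≤ C₁ * w1 d p ^ 2)
    (ψ : SchwartzMap (Hd d) ℂ) :
    ∫⁻ p, ENNReal.ofReal (‖V p‖ * ‖ψ p‖ ^ 2) ≤
      ENNReal.ofReal (C₁ * ((d : ℝ)⁻¹) ^ 2) * ∫⁻ p, ENNReal.ofReal (gradHsq d (⇑ψ) p) := by
  have hd0 : (d : ℝ) ≠ 0 := by positivity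
  calc ∫⁻ p, ENNReal.ofReal (‖V p‖ * ‖ψ p‖ ^ 2)
      ≤ ∫⁻ p, ENNReal.ofReal (C₁ * (d : ℝ)⁻¹ ^ 2) *
          ENNReal.ofReal ((d : ℝ) ^ 2 * (zsq d p * regWeight d p * ‖ψ p‖ ^ 2)) := by
        refine lintegral_mono_ae ?_
        filter_upwards [hV] with p hp
        rw [← ENNReal.ofReal_mul (by positivity)]
        refine ENNReal.ofReal_le_ofReal ?_
        calc ‖V p‖ * ‖ψ p‖ ^ 2 ≤ C₁ * (zsq d p * regWeight d p) * ‖ψ p‖ ^ 2 := by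
              gcongr
              exact hp.trans (by gcongr; exact w1_sq_le d p)
          _ = _ := by field_simp
    _ = ENNReal.ofReal (C₁ * (d : ℝ)⁻¹ ^ 2) *
          ∫⁻ p, ENNReal.ofReal ((d : ℝ) ^ 2 * (zsq d p * regWeight d p * ‖ψ p‖ ^ 2)) :=
        lintegral_const_mul' _ _ ENNReal.ofReal_ne_top
    _ ≤ _ := mul_le_mul_right (lintegral_hardy d ψ) _
end
end
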